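/- Let σ: A* → A* be a substitution such that lim_{k→∞} min_{a∈A} |σ^k(a)| = ∞ (σ is everywhere growing). If the language L_σ is balanced for length 2, then L_σ is factor-balanced. -/

import Mathlib

open List

/-- Number of occurrences of `v` as a factor of `w`, i.e. the number of
decompositions `w = p ++ v ++ s`. -/
def occ {A : Type*} [DecidableEq A] (v w : List A) : ℕ :=
  (List.range (w.length + 1)).countP (fun i => decide (v <+: w.drop i))

/-- Apply a substitution (given by its values on letters) to a word. -/
def applyS {A B : Type*} (σ : A → List B) (w : List A) : List B :=
  (w.map σ).flatten

/-- The iterate `σ^n` of a substitution `σ : A* → A*`, on letters. -/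
def iter {A : Type*} (σ : A → List A) : ℕ → A → List A
  | 0, a => [a]
  | n + 1, a => applyS σ (iter σ n a)

/-- The language of a substitution `σ`: words that are factors of `σ^n(a)` for some
letter `a`, for infinitely many `n`. -/
def LangOf {A : Type*} (σ : A → List A) : Set (List A) :=
  {w | {n : ℕ | ∃ a : A, w <:+: iter σ n a}.Infinite}

section Occurrences

variable {A : Type*} [DecidableEq A]

theorem occ_nil {v : List A} (hv : v ≠ []) : occ v [] = 0 := by
  simp [occ, hv]

theorem occ_cons (v : List A) (a : A) (w : List A) :
    occ v (a :: w) = (if v <+: a :: w then 1 else 0) + occ v w := by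
  unfold occ
  rw [List.length_cons, List.range_succ_eq_map, List.countP_cons, List.countP_map, add_comm]
  congr 1
  simp

theorem occ_le_length {v : List A} (hv : v ≠ []) (w : List A) : occ v w ≤ w.length := by
  induction w with
  | nil => simp [occ_nil hv]
  | cons a w ih =>
    rw [occ_cons, List.length_cons]
    split_ifs <;> omega

theorem occ_le_occ_append_left (v x y : List A) : occ v y ≤ occ v (x ++ y) := by
  induction x with
  | nil => simp
  | cons a x ih =>
    rw [List.cons_append, occ_cons]
    omega

theorem occ_append_le_length_add (v x y : List A) : occ v (x ++ y) ≤ x.length + occ v y := by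
  induction x with
  | nil => simp
  | cons a x ih =>
    rw [List.cons_append, occ_cons, List.length_cons]
    split_ifs <;> omega

theorem occ_le_occ_append_right {v : List A} (hv : v ≠ []) (x y : List A) :
    occ v x ≤ occ v (x ++ y) := by
  induction x with
  | nil => simp [occ_nil hv]
  | cons a x ih =>
    rw [List.cons_append, occ_cons, occ_cons]
    have h : v <+: a :: x → v <+: a :: (x ++ y) := fun h => h.trans ⟨y, by simp⟩
    split_ifs <;> first | omega | tauto

theorem occ_append_le_add_length {v : List A} (hv : v ≠ []) (x y : List A) :
    occ v (x ++ y) ≤ occ v x + y.length + v.length := by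
  induction x with
  | nil =>
    have := occ_le_length hv y
    rw [List.nil_append]
    omega
  | cons a x ih =>
    by_cases hl : v.length ≤ (a :: x).length
    · have h : v <+: a :: (x ++ y) ↔ v <+: a :: x := by
        rw [← List.cons_append]
        exact List.isPrefix_append_of_length hl
      rw [List.cons_append, occ_cons, occ_cons]
      simp only [h]
      omega
    · have := occ_le_length hv (a :: x ++ y)
      rw [List.length_append] at this
      omega

/-- Occurrences of `v` in `x ++ y ++ z` starting inside `x` are seen in `x ++ y` when `y` is
long enough. -/
theorem occ_append_append {v : List A} (x y z : List A) (h : v.length ≤ y.length) :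
    occ v (x ++ (y ++ z)) + occ v y = occ v (y ++ z) + occ v (x ++ y) := by
  induction x with
  | nil => simp
  | cons a x ih =>
    have hp : v <+: a :: (x ++ (y ++ z)) ↔ v <+: a :: (x ++ y) := by
      rw [← List.append_assoc, ← List.cons_append]
      exact List.isPrefix_append_of_length (by simp; omega)
    rw [List.cons_append, List.cons_append, occ_cons, occ_cons]
    simp only [hp]
    omega

end Occurrences

section Substitutions

variable {A B : Type*}

theorem applyS_nil (τ : A → List B) : applyS τ [] = [] := rfl

theorem applyS_cons (τ : A → List B) (a : A) (w : List A) :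
    applyS τ (a :: w) = τ a ++ applyS τ w := by
  simp [applyS]

theorem applyS_append (τ : A → List B) (w w' : List A) :
    applyS τ (w ++ w') = applyS τ w ++ applyS τ w' := by
  simp [applyS]

theorem applyS_applyS {C : Type*} (τ : A → List B) (ρ : B → List C) (w : List A) :
    applyS ρ (applyS τ w) = applyS (fun a => applyS ρ (τ a)) w := by
  induction w with
  | nil => rfl
  | cons a w ih => rw [applyS_cons, applyS_cons, applyS_append, ih]

theorem length_le_length_applyS {τ : A → List B} (hτ : ∀ a, 1 ≤ (τ a).length) (w : List A) :
    w.length ≤ (applyS τ w).length := by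
  induction w with
  | nil => simp
  | cons a w ih =>
    rw [applyS_cons, List.length_append, List.length_cons]
    have := hτ a
    omega

theorem iter_add (σ : A → List A) (m k : ℕ) (a : A) :
    iter σ (m + k) a = applyS (iter σ k) (iter σ m a) := by
  induction k with
  | zero =>
    change iter σ m a = applyS (fun b => [b]) (iter σ m a)
    induction iter σ m a with
    | nil => rfl
    | cons b w ih => rw [applyS_cons, ← ih, List.singleton_append]
  | succ k ih =>
    change applyS σ (iter σ (m + k) a) = _
    rw [ih, applyS_applyS]
    rfl

theorem exists_eq_append_of_prefix_applyS {τ : A → List B} {M : ℕ} (hM : ∀ a, (τ a).length ≤ M)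
    (x : List A) (w : List B) (h : w <+: applyS τ x) :
    ∃ u p, w = applyS τ u ++ p ∧ u <+: x ∧ p.length ≤ M := by
  induction x generalizing w with
  | nil => exact ⟨[], [], by simpa [applyS] using h, List.nil_prefix, by simp⟩
  | cons a x ih =>
    rw [applyS_cons] at h
    obtain ⟨t, ht⟩ := h
    rcases List.append_eq_append_iff.1 ht with ⟨p, hp, -⟩ | ⟨p, hp, hx⟩
    · refine ⟨[], w, by simp [applyS], List.nil_prefix, le_trans ?_ (hM a)⟩
      rw [hp, List.length_append]
      omega
    · obtain ⟨u, q, rfl, hu, hq⟩ := ih p ⟨t, hx.symm⟩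
      refine ⟨a :: u, q, ?_, (List.prefix_cons_inj a).2 hu, hq⟩
      rw [hp, applyS_cons, List.append_assoc]

theorem exists_eq_append_of_infix_applyS {τ : A → List B} {M : ℕ} (hM : ∀ a, (τ a).length ≤ M)
    (x : List A) (w : List B) (h : w <:+: applyS τ x) :
    ∃ s u p, w = s ++ (applyS τ u ++ p) ∧ u <:+: x ∧ s.length ≤ M ∧ p.length ≤ M := by
  induction x with
  | nil => exact ⟨[], [], [], by simpa [applyS] using h, List.infix_rfl, by simp, by simp⟩
  | cons a x ih =>
    rw [applyS_cons, List.infix_append_iff] at h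
    rcases h with h | h | ⟨s, r, rfl, hs, hr⟩
    · exact ⟨w, [], [], by simp [applyS], List.nil_infix, h.length_le.trans (hM a), by simp⟩
    · obtain ⟨s, u, p, hw, hu, hs, hp⟩ := ih h
      exact ⟨s, u, p, hw, hu.trans (List.suffix_cons a x).isInfix, hs, hp⟩
    · obtain ⟨u, p, rfl, hu, hp⟩ := exists_eq_append_of_prefix_applyS hM x r hr
      exact ⟨s, u, p, rfl, hu.isInfix.trans (List.suffix_cons a x).isInfix,
        hs.length_le.trans (hM a), hp⟩

theorem mem_langOf_of_infix {σ : A → List A} {u w : List A} (hw : w ∈ LangOf σ) (h : u <:+: w) :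
    u ∈ LangOf σ :=
  Set.Infinite.mono (s := {n | ∃ a, w <:+: iter σ n a}) (fun _ ⟨a, ha⟩ => ⟨a, h.trans ha⟩) hw

/-- Every word of the language desubstitutes, up to a bounded prefix and suffix, to a word of the
language. -/
theorem exists_desubstitution_of_mem_langOf [Finite A] {σ : A → List A} {k M : ℕ}
    (hk : ∀ a, 1 ≤ (iter σ k a).length) (hM : ∀ a, (iter σ k a).length ≤ M)
    {w : List A} (hw : w ∈ LangOf σ) :
    ∃ s u p, w = s ++ (applyS (iter σ k) u ++ p) ∧ u ∈ LangOf σ ∧ s.length ≤ M ∧ p.length ≤ M := by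
  by_contra! hcon
  set P : List A → Prop := fun u =>
    ∃ s p, w = s ++ (applyS (iter σ k) u ++ p) ∧ s.length ≤ M ∧ p.length ≤ M
  have hfin : {u | P u}.Finite := by
    refine (List.finite_length_le A w.length).subset ?_
    rintro u ⟨s, p, h, -, -⟩
    have h1 := length_le_length_applyS hk u
    have h2 := congrArg List.length h
    simp only [List.length_append] at h2
    change u.length ≤ w.length
    omega
  have hunion : (⋃ u ∈ {u | P u}, {n | ∃ a, u <:+: iter σ n a}).Finite := by
    refine hfin.biUnion fun u hu => ?_
    obtain ⟨s, p, h, hs, hp⟩ := hu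
    by_contra hinf
    exact absurd hp (not_le.2 (hcon s u p h hinf hs))
  refine hw (((hunion.image (· + k)).union (Set.finite_lt_nat k)).subset ?_)
  rintro n ⟨a, ha⟩
  rcases lt_or_ge n k with hn | hn
  · exact Or.inr hn
  · obtain ⟨m, rfl⟩ := Nat.exists_eq_add_of_le' hn
    rw [iter_add] at ha
    obtain ⟨s, u, p, h, hu, hs, hp⟩ := exists_eq_append_of_infix_applyS hM _ _ ha
    refine Or.inl ⟨m, ?_, rfl⟩
    simp only [Set.mem_iUnion]
    exact ⟨u, ⟨s, p, h, hs, hp⟩, a, hu⟩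

end Substitutions

section Balance

variable {A : Type*} [Fintype A] [DecidableEq A]

/-- A quantity whose increments depend only on two consecutive letters is, up to a bounded error,
a linear combination of the numbers of occurrences of words of length two. -/
theorem abs_sub_sum_mul_occ_le {F : List A → ℤ} {c : A → A → ℤ} {M : ℤ}
    (hF : ∀ a b u, F (a :: b :: u) = F (b :: u) + c a b)
    (hnil : |F []| ≤ M) (hone : ∀ a, |F [a]| ≤ M) (u : List A) :
    |F u - ∑ x, ∑ y, c x y * occ [x, y] u| ≤ M := by
  match u with
  | [] => simpa [occ_nil] using hnil
  | [a] => simpa [occ_cons, occ_nil] using hone a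
  | a :: b :: u =>
    have ih := abs_sub_sum_mul_occ_le hF hnil hone (b :: u)
    have hsum : ∑ x, ∑ y, c x y * (occ [x, y] (a :: b :: u) : ℤ)
        = c a b + ∑ x, ∑ y, c x y * (occ [x, y] (b :: u) : ℤ) := by
      have hab : ∑ x, ∑ y, c x y * (if x = a ∧ y = b then (1 : ℤ) else 0) = c a b := by
        simp [ite_and]
      rw [← hab, ← Finset.sum_add_distrib]
      refine Finset.sum_congr rfl fun x _ => ?_
      rw [← Finset.sum_add_distrib]
      refine Finset.sum_congr rfl fun y _ => ?_
      rw [occ_cons [x, y] a]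
      simp [List.cons_prefix_cons, mul_add]
    rw [hF, hsum]
    convert ih using 2
    ring

theorem exists_abs_sub_le_of_balanced {L : Set (List A)} {C : ℕ}
    (hbal : ∀ v : List A, v.length = 2 → ∀ w ∈ L, ∀ w' ∈ L, w.length = w'.length →
      |(occ v w : ℤ) - (occ v w' : ℤ)| ≤ (C : ℤ))
    {F : List A → ℤ} {c : A → A → ℤ} {M : ℤ}
    (hF : ∀ a b u, F (a :: b :: u) = F (b :: u) + c a b)
    (hnil : |F []| ≤ M) (hone : ∀ a, |F [a]| ≤ M) :
    ∃ K : ℤ, ∀ w ∈ L, ∀ w' ∈ L, w.length = w'.length → |F w - F w'| ≤ K := by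
  refine ⟨M + ∑ x, ∑ y, |c x y| * C + M, fun w hw w' hw' h => ?_⟩
  have h1 := abs_sub_sum_mul_occ_le hF hnil hone w
  have h2 := abs_sub_sum_mul_occ_le hF hnil hone w'
  have h3 : |∑ x, ∑ y, c x y * (occ [x, y] w : ℤ) - ∑ x, ∑ y, c x y * (occ [x, y] w' : ℤ)|
      ≤ ∑ x, ∑ y, |c x y| * C := by
    rw [← Finset.sum_sub_distrib]
    refine (Finset.abs_sum_le_sum_abs _ _).trans (Finset.sum_le_sum fun x _ => ?_)
    rw [← Finset.sum_sub_distrib]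
    refine (Finset.abs_sum_le_sum_abs _ _).trans (Finset.sum_le_sum fun y _ => ?_)
    rw [← mul_sub, abs_mul]
    exact mul_le_mul_of_nonneg_left (hbal _ rfl w hw w' hw' h) (abs_nonneg _)
  rw [abs_le] at *
  constructor <;> linarith [h1.1, h1.2, h2.1, h2.2, h3.1, h3.2]

theorem exists_abs_length_applyS_sub_le {B : Type*} {L : Set (List A)} {C : ℕ}
    (hbal : ∀ v : List A, v.length = 2 → ∀ w ∈ L, ∀ w' ∈ L, w.length = w'.length →
      |(occ v w : ℤ) - (occ v w' : ℤ)| ≤ (C : ℤ))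
    {τ : A → List B} {M : ℕ} (hM : ∀ a, (τ a).length ≤ M) :
    ∃ K : ℤ, ∀ w ∈ L, ∀ w' ∈ L, w.length = w'.length →
      |((applyS τ w).length : ℤ) - ((applyS τ w').length : ℤ)| ≤ K :=
  exists_abs_sub_le_of_balanced hbal
    (F := fun u => ((applyS τ u).length : ℤ)) (c := fun a _ => ((τ a).length : ℤ)) (M := M)
    (fun a b u => by rw [applyS_cons τ a]; push_cast [List.length_append]; ring)
    (by simp [applyS_nil]) (fun a => by simpa [applyS_cons, applyS_nil] using hM a)

theorem exists_abs_occ_applyS_sub_le {B : Type*} [DecidableEq B] {L : Set (List A)} {C : ℕ}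
    (hbal : ∀ v : List A, v.length = 2 → ∀ w ∈ L, ∀ w' ∈ L, w.length = w'.length →
      |(occ v w : ℤ) - (occ v w' : ℤ)| ≤ (C : ℤ))
    {τ : A → List B} {v : List B} {M : ℕ} (hv : v ≠ []) (hlen : ∀ a, v.length ≤ (τ a).length)
    (hM : ∀ a, (τ a).length ≤ M) :
    ∃ K : ℤ, ∀ w ∈ L, ∀ w' ∈ L, w.length = w'.length →
      |(occ v (applyS τ w) : ℤ) - (occ v (applyS τ w') : ℤ)| ≤ K := by
  refine exists_abs_sub_le_of_balanced hbal (F := fun u => (occ v (applyS τ u) : ℤ))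
    (c := fun a b => (occ v (τ a ++ τ b) : ℤ) - occ v (τ b)) (M := M) (fun a b u => ?_)
    (by simp [applyS_nil, occ_nil hv]) (fun a => ?_)
  · have := occ_append_append (τ a) (τ b) (applyS τ u) (hlen b)
    simp only [applyS_cons]
    omega
  · have := (occ_le_length hv (τ a)).trans (hM a)
    simpa [applyS_cons, applyS_nil] using this

end Balance

/-- if `σ` is everywhere growing (`min_a |σ^k(a)| → ∞`) and `L_σ` is
balanced for length `2`, then `L_σ` is factor-balanced. -/
theorem factor_balanced_of_growing_substitution {A : Type*} [Fintype A] [DecidableEq A]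
    (σ : A → List A)
    (hgrow : ∀ N : ℕ, ∃ K : ℕ, ∀ k : ℕ, K ≤ k → ∀ a : A, N ≤ (iter σ k a).length)
    (hbal : ∃ C : ℕ, ∀ v : List A, v.length = 2 →
      ∀ w ∈ LangOf σ, ∀ w' ∈ LangOf σ, w.length = w'.length →
        |(occ v w : ℤ) - (occ v w' : ℤ)| ≤ (C : ℤ)) :
    ∀ n : ℕ, 1 ≤ n → ∃ C : ℕ, ∀ v : List A, v.length = n →
      ∀ w ∈ LangOf σ, ∀ w' ∈ LangOf σ, w.length = w'.length →
        |(occ v w : ℤ) - (occ v w' : ℤ)| ≤ (C : ℤ) := by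
  intro n hn
  obtain ⟨C, hC⟩ := hbal
  obtain ⟨k, hk⟩ := hgrow n
  have hlen := hk k le_rfl
  obtain ⟨M, hM⟩ : ∃ M : ℕ, ∀ a, (iter σ k a).length ≤ M :=
    ⟨∑ a, (iter σ k a).length, fun a =>
      Finset.single_le_sum (f := fun a => (iter σ k a).length) (fun _ _ => Nat.zero_le _)
        (Finset.mem_univ a)⟩
  obtain ⟨K, hK⟩ := exists_abs_length_applyS_sub_le hC hM
  have hocc : ∀ v : List A, v.length = n → ∃ D : ℕ, ∀ w ∈ LangOf σ, ∀ w' ∈ LangOf σ,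
      w.length = w'.length → |(occ v w : ℤ) - (occ v w' : ℤ)| ≤ (D : ℤ) := by
    intro v hv
    have hv0 : v ≠ [] := List.ne_nil_of_length_pos (by omega)
    obtain ⟨K', hK'⟩ := exists_abs_occ_applyS_sub_le hC hv0 (fun a => hv ▸ hlen a) hM
    refine ⟨(K' + K + 4 * M + n).toNat, fun w hw w' hw' hww => ?_⟩
    obtain ⟨s, u, p, rfl, hu, hs, hp⟩ :=
      exists_desubstitution_of_mem_langOf (fun a => hn.trans (hlen a)) hM hw
    obtain ⟨s', u', p', rfl, hu', hs', hp'⟩ :=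
      exists_desubstitution_of_mem_langOf (fun a => hn.trans (hlen a)) hM hw'
    refine (?_ : _ ≤ K' + K + 4 * M + n).trans (Int.self_le_toNat _)
    wlog hle : u'.length ≤ u.length generalizing u u' s s' p p'
    · rw [abs_sub_comm]
      exact this s' u' p' hw' hu' hs' hp' s u p hw hww.symm hu hs hp (le_of_not_ge hle)
    set τ := iter σ k
    obtain ⟨x, t, rfl, hx⟩ : ∃ x t, u = x ++ t ∧ x.length = u'.length :=
      ⟨u.take u'.length, u.drop u'.length, (List.take_append_drop _ _).symm, by simpa using hle⟩
    have hxL : x ∈ LangOf σ := mem_langOf_of_infix hu (List.prefix_append x t).isInfix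
    have h1 := abs_le.1 (hK x hxL u' hu' hx)
    have h2 := abs_le.1 (hK' x hxL u' hu' hx)
    rw [applyS_append, List.append_assoc] at hww ⊢
    simp only [List.length_append] at hww
    have a1 := occ_le_occ_append_left v s (applyS τ x ++ (applyS τ t ++ p))
    have a2 := occ_append_le_length_add v s (applyS τ x ++ (applyS τ t ++ p))
    have a3 := occ_le_occ_append_right hv0 (applyS τ x) (applyS τ t ++ p)
    have a4 := occ_append_le_add_length hv0 (applyS τ x) (applyS τ t ++ p)
    have b1 := occ_le_occ_append_left v s' (applyS τ u' ++ p')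
    have b2 := occ_append_le_length_add v s' (applyS τ u' ++ p')
    have b3 := occ_le_occ_append_right hv0 (applyS τ u') p'
    have b4 := occ_append_le_add_length hv0 (applyS τ u') p'
    rw [List.length_append] at a4
    rw [abs_le]
    omega
  choose! D hD using hocc
  obtain ⟨E, hE⟩ := ((List.finite_length_eq A n).image D).bddAbove
  exact ⟨E, fun v hv w hw w' hw' h => (hD v hv w hw w' hw' h).trans
    (Int.ofNat_le.2 (hE ⟨v, hv, rfl⟩))⟩
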